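/- Let D ⊆ ℝ^d be a domain, let n ∈ ℕ, and let c_1, …, c_n be continuous linear functionals on C(cl D; ℝ). Define F : C(cl D; ℝ) → ℝ^n by F(a) = (c_1(a), …, c_n(a)). Then for every compact set K ⊆ C(cl D; ℝ), every σ ∈ A_0, and every ε > 0, there exist L ∈ ℕ and a σ-neural network κ ∈ N_L(σ; ℝ^d × ℝ^d, ℝ^{n×1}) such that sup_{a∈K} sup_{y∈cl D} |F(a) − ∫_D κ(y, x) a(x) dx|₁ ≤ ε, where |·|₁ denotes the ℓ¹ norm on ℝ^n. -/

import Mathlib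

open MeasureTheory Filter
open scoped ENNReal BigOperators

noncomputable section

/-- `IsNNRep σ n m f` : `f` is of the form `x ↦ W_n σ(… W_1 σ(W_0 x + b_0) + b_1 …) + b_n`
with output dimension `m`. -/
def IsNNRep (σ : ℝ → ℝ) {ι : Type*} [Fintype ι] :
    ℕ → (m : ℕ) → ((ι → ℝ) → (Fin m → ℝ)) → Prop
  | 0, m, f => ∃ (W : Matrix (Fin m) ι ℝ) (b : Fin m → ℝ),
      f = fun x => W.mulVec x + b
  | n + 1, m, f => ∃ (k : ℕ) (g : (ι → ℝ) → (Fin k → ℝ))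
      (W : Matrix (Fin m) (Fin k) ℝ) (b : Fin m → ℝ),
      IsNNRep σ n k g ∧ f = fun x => W.mulVec (fun i => σ (g x i)) + b

/-- `f` is an `n`-layer real-valued `σ`-neural network. -/
def IsNN (σ : ℝ → ℝ) {ι : Type*} [Fintype ι] (n : ℕ) (f : (ι → ℝ) → ℝ) : Prop :=
  ∃ g : (ι → ℝ) → (Fin 1 → ℝ), IsNNRep σ n 1 g ∧ f = fun x => g x 0

/-- vector-valued neural networks, componentwise. -/
def IsNNV (σ : ℝ → ℝ) {ι : Type*} [Fintype ι] (n : ℕ) {m : ℕ}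
    (f : (ι → ℝ) → (Fin m → ℝ)) : Prop :=
  ∀ i : Fin m, IsNN σ n fun x => f x i

/-- matrix-valued neural networks, entrywise. -/
def IsNNM (σ : ℝ → ℝ) {ι : Type*} [Fintype ι] (n : ℕ) {a b : ℕ}
    (f : (ι → ℝ) → Matrix (Fin a) (Fin b) ℝ) : Prop :=
  ∀ (i : Fin a) (j : Fin b), IsNN σ n fun x => f x i j

/-- The class `A_0` of activation functions. -/
def MemA0 (σ : ℝ → ℝ) : Prop :=
  Continuous σ ∧ ∃ n : ℕ, ∀ (k : ℕ) (K : Set (Fin k → ℝ)), IsCompact K →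
    ∀ f : (Fin k → ℝ) → ℝ, ContinuousOn f K → ∀ ε : ℝ, 0 < ε →
      ∃ g : (Fin k → ℝ) → ℝ, IsNN σ n g ∧ ∀ x ∈ K, |f x - g x| ≤ ε

/-- The class `A^L_0` of linearly bounded activation functions. -/
def MemAL0 (σ : ℝ → ℝ) : Prop :=
  MemA0 σ ∧ Measurable σ ∧ ∃ C : ℝ, ∀ x : ℝ, |σ x| ≤ C * (1 + |x|)

/-- The class `BA` of activations admitting bounded approximations to the identity. -/
def MemBA (σ : ℝ → ℝ) : Prop :=
  MemA0 σ ∧ ∀ (k : ℕ) (K : Set (Fin k → ℝ)), IsCompact K →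
    ∀ ε : ℝ, 0 < ε → ∀ C : ℝ, 0 ≤ C →
      (∀ x ∈ K, ∀ y ∈ K, Real.sqrt (∑ i, (x i - y i) ^ 2) ≤ C) →
      ∃ (n : ℕ) (f : (Fin k → ℝ) → (Fin k → ℝ)), IsNNV σ n f ∧
        (∀ x ∈ K, Real.sqrt (∑ i, (f x i - x i) ^ 2) ≤ ε) ∧
        ∀ x, Real.sqrt (∑ i, (f x i) ^ 2) ≤ C

/-- A domain: bounded, connected, open, topologically regular. -/
def IsRegularDomain {k : ℕ} (D : Set (Fin k → ℝ)) : Prop :=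
  IsOpen D ∧ IsConnected D ∧ Bornology.IsBounded D ∧ interior (closure D) = D

/-- affine kernel integral operators `IO(σ; D, ℝ^{d1}, ℝ^{d2})`. -/
def IsIO (σ : ℝ → ℝ) {d : ℕ} (D : Set (Fin d → ℝ)) (d1 d2 : ℕ)
    (S : ((Fin d → ℝ) → (Fin d1 → ℝ)) → ((Fin d → ℝ) → (Fin d2 → ℝ))) : Prop :=
  ∃ (n1 n2 : ℕ) (κ : ((Fin d ⊕ Fin d) → ℝ) → Matrix (Fin d2) (Fin d1) ℝ)
    (b : (Fin d → ℝ) → (Fin d2 → ℝ)),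
    IsNNM σ n1 κ ∧ IsNNV σ n2 b ∧
    S = fun f x => (∫ y in D, (κ (Sum.elim x y)).mulVec (f y)) + b x

/-- The chain `S_{n-1} σ1 (⋯ S_2 σ1 (S_1 (S_0 f)) ⋯)` of `n` integral operators. -/
inductive NOChain (σ1 σ2 : ℝ → ℝ) {d : ℕ} (D : Set (Fin d → ℝ)) (da : ℕ) :
    ℕ → (m : ℕ) → (((Fin d → ℝ) → (Fin da → ℝ)) → ((Fin d → ℝ) → (Fin m → ℝ))) → Prop
  | base {d0 d1 : ℕ}
      {S0 : ((Fin d → ℝ) → (Fin da → ℝ)) → ((Fin d → ℝ) → (Fin d0 → ℝ))}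
      {S1 : ((Fin d → ℝ) → (Fin d0 → ℝ)) → ((Fin d → ℝ) → (Fin d1 → ℝ))}
      (h0 : IsIO σ2 D da d0 S0) (h1 : IsIO σ2 D d0 d1 S1) :
      NOChain σ1 σ2 D da 2 d1 fun f => S1 (S0 f)
  | step {n m m' : ℕ}
      {V : ((Fin d → ℝ) → (Fin da → ℝ)) → ((Fin d → ℝ) → (Fin m → ℝ))}
      {S : ((Fin d → ℝ) → (Fin m → ℝ)) → ((Fin d → ℝ) → (Fin m' → ℝ))}
      (hV : NOChain σ1 σ2 D da n m V) (hS : IsIO σ2 D m m' S) :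
      NOChain σ1 σ2 D da (n + 1) m' fun f => S fun y i => σ1 (V f y i)

/-- `n`-layer neural operators `NO_n(σ1, σ2, σ3; D, D', ℝ^{da}, ℝ^{du})`. -/
def IsNO (σ1 σ2 σ3 : ℝ → ℝ) {d d' : ℕ} (D : Set (Fin d → ℝ)) (D' : Set (Fin d' → ℝ))
    (da du n : ℕ)
    (G : ((Fin d → ℝ) → (Fin da → ℝ)) → ((Fin d' → ℝ) → (Fin du → ℝ))) : Prop :=
  ∃ (m : ℕ) (V : ((Fin d → ℝ) → (Fin da → ℝ)) → ((Fin d → ℝ) → (Fin m → ℝ)))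
    (l : ℕ) (κ : ((Fin d' ⊕ Fin d) → ℝ) → Matrix (Fin du) (Fin m) ℝ),
    NOChain σ1 σ2 D da n m V ∧ IsNNM σ3 l κ ∧
    G = fun f x => ∫ y in D, (κ (Sum.elim x y)).mulVec (V f y)

open Classical in
/-- Extension by zero of a bounded continuous function on a subset. -/
noncomputable def extendZero {α : Type*} [TopologicalSpace α] {s : Set α}
    (u : BoundedContinuousFunction s ℝ) : α → ℝ :=
  fun x => if h : x ∈ s then u ⟨x, h⟩ else 0

section Networks

variable {σ : ℝ → ℝ} {ι ι' : Type*} [Fintype ι] [Fintype ι']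

theorem IsNNRep.continuous (hσ : Continuous σ) {n m : ℕ} {f : (ι → ℝ) → (Fin m → ℝ)}
    (hf : IsNNRep σ n m f) : Continuous f := by
  induction n generalizing m with
  | zero =>
    obtain ⟨W, b, rfl⟩ := hf
    exact (continuous_const.matrix_mulVec continuous_id).add continuous_const
  | succ n ih =>
    obtain ⟨k, g, W, b, hg, rfl⟩ := hf
    have := ih hg
    exact (continuous_const.matrix_mulVec
      (continuous_pi fun i => hσ.comp ((continuous_apply i).comp this))).add continuous_const

theorem IsNN.continuous (hσ : Continuous σ) {n : ℕ} {f : (ι → ℝ) → ℝ} (hf : IsNN σ n f) :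
    Continuous f := by
  obtain ⟨g, hg, rfl⟩ := hf
  exact (continuous_apply 0).comp (hg.continuous hσ)

theorem IsNNRep.comp_inr {n m : ℕ} {f : (ι → ℝ) → (Fin m → ℝ)} (hf : IsNNRep σ n m f) :
    IsNNRep σ n m fun u : (ι' ⊕ ι) → ℝ => f (u ∘ Sum.inr) := by
  induction n generalizing m with
  | zero =>
    obtain ⟨W, b, rfl⟩ := hf
    refine ⟨Matrix.fromCols 0 W, b, ?_⟩
    funext u
    simp [Matrix.fromCols_mulVec]
  | succ n ih =>
    obtain ⟨k, g, W, b, hg, rfl⟩ := hf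
    exact ⟨k, _, W, b, ih hg, rfl⟩

theorem IsNN.comp_inr {n : ℕ} {f : (ι → ℝ) → ℝ} (hf : IsNN σ n f) :
    IsNN σ n fun u : (ι' ⊕ ι) → ℝ => f (u ∘ Sum.inr) := by
  obtain ⟨g, hg, rfl⟩ := hf
  exact ⟨_, hg.comp_inr, rfl⟩

end Networks

theorem extendZero_of_mem {α : Type*} [TopologicalSpace α] {s : Set α}
    (u : BoundedContinuousFunction s ℝ) {x : α} (hx : x ∈ s) : extendZero u x = u ⟨x, hx⟩ := by
  simp [extendZero, hx]

theorem continuousOn_extendZero {α : Type*} [TopologicalSpace α] {s : Set α}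
    (u : BoundedContinuousFunction s ℝ) : ContinuousOn (extendZero u) s := by
  rw [continuousOn_iff_continuous_domRestrict]
  exact u.continuous.congr fun x => (extendZero_of_mem u x.2).symm

theorem abs_extendZero_le {α : Type*} [TopologicalSpace α] {s : Set α}
    (u : BoundedContinuousFunction s ℝ) (x : α) : |extendZero u x| ≤ ‖u‖ := by
  by_cases hx : x ∈ s
  · rw [extendZero_of_mem u hx]
    exact u.norm_coe_le_norm _
  · simp [extendZero, hx]

/-- A compact set of bounded continuous functions on a compact space is uniformly
equicontinuous. -/
theorem exists_dist_lt_of_isCompact {X : Type*} [PseudoMetricSpace X] [CompactSpace X]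
    {K : Set (BoundedContinuousFunction X ℝ)} (hK : IsCompact K) {η : ℝ} (hη : 0 < η) :
    ∃ δ > 0, ∀ a ∈ K, ∀ x y : X, dist x y < δ → |a x - a y| < η := by
  have : CompactSpace K := isCompact_iff_compactSpace.1 hK
  have hc : Continuous fun p : K × X => (p.1 : BoundedContinuousFunction X ℝ) p.2 := by
    fun_prop
  obtain ⟨δ, hδ, h⟩ :=
    Metric.uniformContinuous_iff.1 (CompactSpace.uniformContinuous_of_continuous hc) η hη
  refine ⟨δ, hδ, fun a ha x y hxy => ?_⟩
  exact h (a := (⟨a, ha⟩, x)) (b := (⟨a, ha⟩, y)) (by simpa [Prod.dist_eq, hδ] using hxy)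

section Averaging

variable {α : Type*} [MetricSpace α] [MeasurableSpace α] [BorelSpace α]
  {μ : Measure α} [IsFiniteMeasureOnCompacts μ] {D : Set α}

theorem exists_averaging_kernel [μ.IsOpenPosMeasure] (hD : IsOpen D)
    (hc : IsCompact (closure D)) {δ : ℝ} (hδ : 0 < δ) :
    ∃ k : α → C(closure D, ℝ), Continuous k ∧ (∀ x y, 0 ≤ k x y) ∧
      (∀ (x : α) (y : closure D), δ ≤ dist x y → k x y = 0) ∧ ∀ y, ∫ x in D, k x y ∂μ = 1 := by
  let ψ : α → closure D → ℝ := fun x y => max 0 (δ - dist x y)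
  have hψ : Continuous fun p : α × closure D => ψ p.1 p.2 := by fun_prop
  have hψ0 : ∀ x y, 0 ≤ ψ x y := fun x y => le_max_left _ _
  have hψx : ∀ y, Continuous fun x => ψ x y := fun y => by fun_prop
  have hint : ∀ y, IntegrableOn (fun x => ψ x y) D μ := fun y =>
    ((hψx y).continuousOn.integrableOn_compact hc).mono_set subset_closure
  let m : closure D → ℝ := fun y => ∫ x in D, ψ x y ∂μ
  have hμD : μ D < ∞ := (measure_mono subset_closure).trans_lt hc.measure_lt_top
  have hm : Continuous m := by
    refine continuous_of_dominated (bound := fun _ => δ)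
      (fun y => (hint y).aestronglyMeasurable) (fun y => ?_)
      (integrableOn_const hμD.ne) (Eventually.of_forall fun x => by fun_prop)
    refine Eventually.of_forall fun x => ?_
    rw [Real.norm_of_nonneg (hψ0 x y)]
    exact max_le hδ.le (by linarith [dist_nonneg (x := x) (y := (y : α))])
  have hmpos : ∀ y, 0 < m y := by
    intro y
    rw [setIntegral_pos_iff_support_of_nonneg_ae
      (Eventually.of_forall fun x => hψ0 x y) (hint y)]
    have hne : (Metric.ball (y : α) δ ∩ D).Nonempty :=
      mem_closure_iff.1 y.2 _ Metric.isOpen_ball (Metric.mem_ball_self hδ)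
    refine ((Metric.isOpen_ball.inter hD).measure_pos μ hne).trans_le (measure_mono ?_)
    refine Set.inter_subset_inter_left _ fun x hx => ?_
    have : 0 < δ - dist x y := sub_pos.2 hx
    exact (lt_max_of_lt_right this).ne'
  have hk : Continuous fun p : α × closure D => ψ p.1 p.2 / m p.2 :=
    hψ.div (hm.comp continuous_snd) fun p => (hmpos p.2).ne'
  refine ⟨(ContinuousMap.curry ⟨_, hk⟩), (ContinuousMap.curry ⟨_, hk⟩).continuous,
    fun x y => div_nonneg (hψ0 x y) (hmpos y).le, fun x y hxy => ?_, fun y => ?_⟩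
  · have : ψ x y = 0 := max_eq_left (by linarith)
    simp [this]
  · simp only [ContinuousMap.curry_apply, ContinuousMap.coe_mk]
    rw [integral_div]
    exact div_self (hmpos y).ne'

/-- On a compact set of functions, a continuous linear functional is uniformly approximated by
integration against a continuous density. -/
theorem exists_continuous_density [μ.IsOpenPosMeasure] (hD : IsOpen D)
    (hc : IsCompact (closure D)) (c : BoundedContinuousFunction (closure D) ℝ →L[ℝ] ℝ)
    {K : Set (BoundedContinuousFunction (closure D) ℝ)} (hK : IsCompact K)
    {ε : ℝ} (hε : 0 < ε) :
    ∃ g : α → ℝ, Continuous g ∧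
      ∀ a ∈ K, |c a - ∫ x in D, g x * extendZero a x ∂μ| ≤ ε := by
  have : CompactSpace (closure D) := isCompact_iff_compactSpace.1 hc
  have hη : 0 < ε / (‖c‖ + 1) := by positivity
  obtain ⟨δ, hδ, hKδ⟩ := exists_dist_lt_of_isCompact hK hη
  obtain ⟨k, hk, hk0, hksupp, hk1⟩ := exists_averaging_kernel (μ := μ) hD hc hδ
  let B := ContinuousMap.linearIsometryBoundedOfCompact (closure D) ℝ ℝ
  let c' : C(closure D, ℝ) →L[ℝ] ℝ := c.comp (B : C(closure D, ℝ) →L[ℝ] _)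
  refine ⟨fun x => c' (k x), c'.continuous.comp hk, fun a ha => ?_⟩
  have hint {f : α → ℝ} (hf : ContinuousOn f (closure D)) :
      IntegrableOn f D μ := (hf.integrableOn_compact hc).mono_set subset_closure
  have hi : IntegrableOn (fun x => extendZero a x • k x) D μ :=
    ((continuousOn_extendZero a).smul hk.continuousOn).integrableOn_compact hc
      |>.mono_set subset_closure
  let T : C(closure D, ℝ) := ∫ x in D, extendZero a x • k x ∂μ
  have hT : ∫ x in D, c' (k x) * extendZero a x ∂μ = c (B T) := by
    rw [show c (B T) = c' T from rfl, ← c'.integral_comp_comm hi]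
    simp [mul_comm]
  have hTy : ∀ y, T y = ∫ x in D, extendZero a x * k x y ∂μ := fun y =>
    ((ContinuousMap.evalCLM ℝ y).integral_comp_comm hi).symm
  have hky : ∀ y, Continuous fun x => k x y := fun y => by fun_prop
  have hclose : ‖a - B T‖ ≤ ε / (‖c‖ + 1) := by
    refine (BoundedContinuousFunction.norm_le hη.le).2 fun y => ?_
    have hay : a y = ∫ x in D, a y * k x y ∂μ := by rw [integral_const_mul, hk1, mul_one]
    have h1 : IntegrableOn (fun x => a y * k x y) D μ :=
      hint (continuous_const.mul (hky y)).continuousOn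
    have h2 : IntegrableOn (fun x => extendZero a x * k x y) D μ :=
      hint ((continuousOn_extendZero a).mul (hky y).continuousOn)
    have h3 : IntegrableOn (fun x => ε / (‖c‖ + 1) * k x y) D μ :=
      hint (continuous_const.mul (hky y)).continuousOn
    calc ‖a y - T y‖ = ‖∫ x in D, (a y * k x y - extendZero a x * k x y) ∂μ‖ := by
          rw [integral_sub h1 h2, ← hay, hTy]
      _ ≤ ∫ x in D, ε / (‖c‖ + 1) * k x y ∂μ := by
          refine norm_integral_le_of_norm_le h3 ?_
          refine (ae_restrict_iff' hD.measurableSet).2 (Eventually.of_forall fun x hx => ?_)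
          rw [← sub_mul, norm_mul, Real.norm_of_nonneg (hk0 x y)]
          rcases lt_or_ge (dist x y) δ with h | h
          · refine mul_le_mul_of_nonneg_right ?_ (hk0 x y)
            rw [extendZero_of_mem a (subset_closure hx)]
            exact (hKδ a ha y ⟨x, subset_closure hx⟩ (by rwa [dist_comm])).le
          · simp [hksupp x y h]
      _ = ε / (‖c‖ + 1) := by rw [integral_const_mul, hk1, mul_one]
  rw [hT, ← map_sub]
  calc ‖c (a - B T)‖ ≤ ‖c‖ * (ε / (‖c‖ + 1)) := c.le_opNorm_of_le hclose
    _ ≤ (‖c‖ + 1) * (ε / (‖c‖ + 1)) := by gcongr; linarith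
    _ = ε := by field_simp

/-- Replacing a continuous density by a uniformly close one changes its integral against `a` by
at most the distance times `‖a‖ * μ D`. -/
theorem abs_setIntegral_density_sub_le (hc : IsCompact (closure D))
    {f g : α → ℝ} (hf : Continuous f) (hg : Continuous g) {η : ℝ}
    (hfg : ∀ x ∈ closure D, |f x - g x| ≤ η)
    (a : BoundedContinuousFunction (closure D) ℝ) :
    |∫ x in D, f x * extendZero a x ∂μ - ∫ x in D, g x * extendZero a x ∂μ| ≤
      η * ‖a‖ * μ.real D := by
  have hint {h : α → ℝ} (hh : Continuous h) :
      IntegrableOn (fun x => h x * extendZero a x) D μ :=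
    ((hh.continuousOn.mul (continuousOn_extendZero a)).integrableOn_compact hc).mono_set
      subset_closure
  rw [← integral_sub (hint hf) (hint hg), ← Real.norm_eq_abs]
  refine norm_setIntegral_le_of_norm_le_const
    ((measure_mono subset_closure).trans_lt hc.measure_lt_top) fun x hx => ?_
  have h := hfg x (subset_closure hx)
  rw [← sub_mul, norm_mul]
  exact mul_le_mul h (abs_extendZero_le a x) (abs_nonneg _) ((abs_nonneg _).trans h)

end Averaging

/-- Finitely many continuous linear functionals on `C(cl D; ℝ)` can be simultaneously
approximated, uniformly over a compact set and over `y ∈ cl D`, by a neural-network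
kernel integral operator (Lemma D.1 for the continuous case). -/
theorem functionals_approx_by_nn_kernel_C
    (d n : ℕ) (D : Set (Fin d → ℝ)) (hD : IsRegularDomain D)
    (c : Fin n → (BoundedContinuousFunction (closure D) ℝ →L[ℝ] ℝ))
    (K : Set (BoundedContinuousFunction (closure D) ℝ)) (hK : IsCompact K)
    (σ : ℝ → ℝ) (hσ : MemA0 σ) (ε : ℝ) (hε : 0 < ε) :
    ∃ (L : ℕ) (κ : ((Fin d ⊕ Fin d) → ℝ) → Matrix (Fin n) (Fin 1) ℝ),
      IsNNM σ L κ ∧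
      ∀ a ∈ K, ∀ y ∈ closure D,
        ∑ i : Fin n,
          |c i a - ∫ x in D, κ (Sum.elim y x) i 0 * extendZero a x| ≤ ε := by
  have hc : IsCompact (closure D) := hD.2.2.1.isCompact_closure
  obtain ⟨hσc, L, happ⟩ := hσ
  obtain ⟨M, hM0, hM⟩ := hK.isBounded.exists_pos_norm_le
  set V := (volume : Measure (Fin d → ℝ)).real D
  have hV : 0 ≤ V := measureReal_nonneg
  set e := ε / (2 * (n + 1)) with he
  have he0 : 0 < e := by positivity
  set η := e / (M * V + 1) with hη
  have hη0 : 0 < η := by positivity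
  choose g hg hgc using fun i =>
    exists_continuous_density (μ := volume) hD.1 hc (c i) hK he0
  choose f hf hfg using fun i => happ d (closure D) hc (g i) (hg i).continuousOn η hη0
  refine ⟨L, fun u => Matrix.of fun i _ => f i (u ∘ Sum.inr), fun i _ => (hf i).comp_inr,
    fun a ha y _ => ?_⟩
  have hterm : ∀ i, |c i a - ∫ x in D, f i x * extendZero a x| ≤ 2 * e := by
    intro i
    have h1 := hgc i a ha
    have h2 := abs_setIntegral_density_sub_le (μ := volume) hc (hg i)
      ((hf i).continuous hσc) (hfg i) a
    have h3 : η * ‖a‖ * V ≤ e := by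
      calc η * ‖a‖ * V ≤ η * M * V := by gcongr; exact hM a ha
        _ ≤ η * (M * V + 1) := by linarith
        _ = e := by rw [hη]; field_simp
    linarith [abs_sub_le (c i a) (∫ x in D, g i x * extendZero a x)
      (∫ x in D, f i x * extendZero a x)]
  calc _ ≤ ∑ _i : Fin n, 2 * e := Finset.sum_le_sum fun i _ => hterm i
    _ = n * (ε / (n + 1)) := by
      rw [Finset.sum_const, Finset.card_univ, Fintype.card_fin, nsmul_eq_mul, he]
      field_simp
    _ ≤ (n + 1) * (ε / (n + 1)) := by gcongr; linarith
    _ = ε := by field_simp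

end
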